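/- Product formula for the odd trigonometric collocation coefficients: for every x ∈ ℝ and every j ∈ ℕ, ∫₀¹ φ₀((1−ξ)²x) p̂_{2j+1}(ξ) dξ = √(4j+3) · (−1)ʲ ( (2j+2)! / (4j+4)! ) x^{j+1} · ( Σ_{l≥0} (−x/16)ˡ / ( (3/2)ₗ l! ) ) · ( Σ_{l≥0} (−x/16)ˡ / ( (2j+5/2)ₗ l! ) ). -/

import Mathlib

/-- The shifted Legendre polynomial of degree `j` on `[0,1]`,
`p̂ⱼ(τ) = (-1)ʲ √(2j+1) Σ_{k=0}^{j} C(j,k) C(j+k,k) (-τ)ᵏ`. -/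
noncomputable def legendreShifted (j : ℕ) (τ : ℝ) : ℝ :=
  (-1 : ℝ) ^ j * Real.sqrt (2 * j + 1) *
    ∑ k ∈ Finset.range (j + 1),
      (j.choose k : ℝ) * ((j + k).choose k : ℝ) * (-τ) ^ k

/-- `φ₀(x) = Σ_{l≥0} (-1)ˡ xˡ/(2l)!` for `x ∈ ℝ`. -/
noncomputable def phiZeroReal (x : ℝ) : ℝ :=
  ∑' l : ℕ, (-1 : ℝ) ^ l * x ^ l / (Nat.factorial (2 * l) : ℝ)

open Finset Polynomial

/-- Chu-Vandermonde convolution of the reciprocals of Pochhammer symbols. -/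
theorem sum_antidiagonal_inv_ascPochhammer {c d : ℝ} (hc : 0 < c) (hd : 0 < d) (m : ℕ) :
    ∑ p ∈ antidiagonal m,
        1 / ((ascPochhammer ℝ p.1).eval c * (Nat.factorial p.1 : ℝ)) *
          (1 / ((ascPochhammer ℝ p.2).eval d * (Nat.factorial p.2 : ℝ))) =
      (ascPochhammer ℝ m).eval (c + d + m - 1) /
        ((Nat.factorial m : ℝ) * (ascPochhammer ℝ m).eval c * (ascPochhammer ℝ m).eval d) := by
  have smeval_eq (r : ℝ) (n : ℕ) :
      (descPochhammer ℤ n).smeval r = (ascPochhammer ℝ n).eval (r - n + 1) := by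
    rw [descPochhammer_smeval_eq_ascPochhammer, ascPochhammer_smeval_cast,
      ascPochhammer_smeval_eq_eval]
  have split (r : ℝ) (i k : ℕ) : (ascPochhammer ℝ (i + k)).eval r =
      (ascPochhammer ℝ i).eval r * (ascPochhammer ℝ k).eval (r + i) := by
    rw [← ascPochhammer_mul]
    simp
  have vandermonde := Ring.descPochhammer_smeval_add (r := d + m - 1) (s := c + m - 1) m
    (Commute.all _ _)
  simp only [smeval_eq] at vandermonde
  rw [show d + m - 1 + (c + m - 1) - m + 1 = c + d + m - 1 by ring] at vandermonde
  rw [vandermonde, Finset.sum_div]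
  refine Finset.sum_congr rfl fun p hp => ?_
  obtain ⟨i, k⟩ := p
  obtain rfl : i + k = m := by simpa using hp
  have hci := ascPochhammer_pos i c hc
  have hdk := ascPochhammer_pos k d hd
  have hdm := ascPochhammer_pos i (d + k) (by positivity)
  have hcm' := ascPochhammer_pos k (c + i) (by positivity)
  have hchoose : ((i + k).choose i : ℝ) * i.factorial * k.factorial = (i + k).factorial := by
    rw [Nat.choose_symm_add]
    exact_mod_cast Nat.add_choose_mul_factorial_mul_factorial i k
  rw [split c i k, show (ascPochhammer ℝ (i + k)).eval d =
    (ascPochhammer ℝ k).eval d * (ascPochhammer ℝ i).eval (d + k) by rw [add_comm, split],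
    ← hchoose]
  simp only [Nat.cast_add]
  rw [show d + (i + k : ℝ) - 1 - i + 1 = d + k by ring,
    show c + (i + k : ℝ) - 1 - k + 1 = c + i by ring]
  have hpos : (0 : ℝ) < (i + k).choose i := by
    exact_mod_cast Nat.choose_pos (Nat.le_add_right i k)
  field_simp

theorem ascPochhammer_three_halves_mul (m : ℕ) :
    (ascPochhammer ℝ m).eval (3 / 2 : ℝ) * m.factorial * 4 ^ m = (2 * m + 1).factorial := by
  induction m with
  | zero => simp
  | succ m ih =>
    rw [ascPochhammer_succ_eval, show 2 * (m + 1) + 1 = 2 * m + 1 + 1 + 1 by ring,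
      Nat.factorial_succ (2 * m + 1 + 1), Nat.factorial_succ (2 * m + 1), Nat.factorial_succ m]
    push_cast
    rw [← ih]
    ring

theorem ascPochhammer_add_half_mul (n m : ℕ) :
    (ascPochhammer ℝ m).eval (n + 1 / 2 : ℝ) * (n + m).factorial * (2 * n).factorial * 4 ^ m =
      (2 * n + 2 * m).factorial * n.factorial := by
  induction m with
  | zero => simp; ring
  | succ m ih =>
    rw [ascPochhammer_succ_eval, show 2 * n + 2 * (m + 1) = 2 * n + 2 * m + 1 + 1 by ring,
      Nat.factorial_succ (2 * n + 2 * m + 1), Nat.factorial_succ (2 * n + 2 * m),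
      ← add_assoc, Nat.factorial_succ (n + m)]
    push_cast
    linear_combination (2 * (n:ℝ) + 2 * m + 1) * (2 * n + 2 * m + 2) * ih

theorem factorial_mul_ascPochhammer_eval (n m : ℕ) :
    (n.factorial : ℝ) * (ascPochhammer ℝ m).eval (n + 1 : ℝ) = (n + m).factorial := by
  induction m with
  | zero => simp
  | succ m ih =>
    rw [ascPochhammer_succ_eval, ← add_assoc, Nat.factorial_succ]
    push_cast
    rw [← ih]
    ring

theorem sum_antidiagonal_inv_ascPochhammer_half (j m : ℕ) :
    ∑ p ∈ antidiagonal m,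
        1 / ((ascPochhammer ℝ p.1).eval (3 / 2 : ℝ) * (Nat.factorial p.1 : ℝ)) *
          (1 / ((ascPochhammer ℝ p.2).eval ((2 * j : ℝ) + 5 / 2) * (Nat.factorial p.2 : ℝ))) =
      16 ^ m * ((2 * j + 2 + 2 * m).factorial * (4 * j + 4).factorial : ℝ) /
        ((2 * m + 1).factorial * (4 * j + 4 + 2 * m).factorial * (2 * j + 2).factorial) := by
  rw [sum_antidiagonal_inv_ascPochhammer (by norm_num) (by positivity)]
  have h1 := ascPochhammer_three_halves_mul m
  have h2 := ascPochhammer_add_half_mul (2 * j + 2) m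
  have h3 := factorial_mul_ascPochhammer_eval (2 * j + 2 + m) m
  rw [show 2 * j + 2 + m + m = 2 * j + 2 + 2 * m by ring] at h3
  rw [show 2 * (2 * j + 2) = 4 * j + 4 by ring] at h2
  push_cast at h2 h3
  rw [show (2 * j + 2 + 1 / 2 : ℝ) = 2 * j + 5 / 2 by ring] at h2
  rw [show (3 / 2 + (2 * j + 5 / 2) + m - 1 : ℝ) = 2 * j + 2 + m + 1 by ring]
  have p1 := ascPochhammer_pos m (3 / 2 : ℝ) (by norm_num)
  have p2 := ascPochhammer_pos m (2 * j + 5 / 2 : ℝ) (by positivity)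
  rw [← h3, ← h1, div_eq_div_iff (by positivity) (by positivity)]
  have h16 : (16 : ℝ) ^ m = 4 ^ m * 4 ^ m := by rw [← mul_pow]; norm_num
  rw [h16]
  linear_combination (-(m.factorial : ℝ) * (ascPochhammer ℝ m).eval (3 / 2 : ℝ) * 4 ^ m *
    (ascPochhammer ℝ m).eval (2 * j + 2 + m + 1 : ℝ)) * h2

theorem summable_pow_div_ascPochhammer_mul_factorial {c : ℝ} (hc : 1 ≤ c) (y : ℝ) :
    Summable fun l : ℕ => ‖y ^ l / ((ascPochhammer ℝ l).eval c * (Nat.factorial l : ℝ))‖ := by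
  have one_le (l : ℕ) : 1 ≤ (ascPochhammer ℝ l).eval c := by
    induction l with
    | zero => simp
    | succ l ih =>
      rw [ascPochhammer_succ_eval]
      exact one_le_mul_of_one_le_of_one_le ih (by linarith [Nat.cast_nonneg (α := ℝ) l])
  refine Summable.of_nonneg_of_le (fun _ => norm_nonneg _) (fun l => ?_)
    (Real.summable_pow_div_factorial |y|)
  have hl := one_le l
  rw [norm_div, norm_pow, Real.norm_eq_abs, Real.norm_of_nonneg (by positivity)]
  gcongr
  exact le_mul_of_one_le_left (by positivity) hl

theorem summable_pow_div_two_mul_factorial (y : ℝ) :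
    Summable fun l : ℕ => |y| ^ l / (Nat.factorial (2 * l) : ℝ) := by
  refine Summable.of_nonneg_of_le (fun _ => by positivity) (fun l => ?_)
    (Real.summable_pow_div_factorial |y|)
  gcongr
  omega

theorem sum_alternating_choose_mul_choose (n K : ℕ) :
    ∑ k ∈ range (K + 1), (-1 : ℝ) ^ k * (n + 1).choose k * (n + k).choose k =
      (-1) ^ K * n.choose K * (n + 1 + K).choose K := by
  induction K with
  | zero => simp
  | succ K ih =>
    rw [Finset.sum_range_succ, ih]
    have h1 : ((n + 1).choose (K + 1) : ℝ) = n.choose K + n.choose (K + 1) := by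
      exact_mod_cast Nat.choose_succ_succ n K
    have h2 : ((n + 1 + (K + 1)).choose (K + 1) : ℝ) =
        (n + 1 + K).choose K + (n + 1 + K).choose (K + 1) := by
      exact_mod_cast Nat.choose_succ_succ (n + 1 + K) K
    have h3 : ((n + 1 + K).choose (K + 1) : ℝ) * (K + 1) = (n + 1 + K).choose K * (n + 1) := by
      have := Nat.choose_succ_right_eq (n + 1 + K) K
      rw [Nat.add_sub_cancel] at this
      exact_mod_cast this
    have h4 : (n.choose (K + 1) : ℝ) * (K + 1) = n.choose K * (n - K) := by
      rcases le_or_gt K n with h | h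
      · have := Nat.choose_succ_right_eq n K
        rw [← Nat.cast_sub h]
        exact_mod_cast this
      · simp [Nat.choose_eq_zero_of_lt h, Nat.choose_eq_zero_of_lt (Nat.lt_succ_of_lt h)]
    rw [show n + (K + 1) = n + 1 + K by ring, h1, h2]
    have hK : (K + 1 : ℝ) ≠ 0 := by positivity
    rw [eq_div_of_mul_eq hK h3, eq_div_of_mul_eq hK h4]
    field_simp
    ring

/-- The moment `∫₀¹ s^(z-1) P(s) ds` of the shifted Legendre polynomial, as a finite sum. -/
noncomputable def legendreMoment (n : ℕ) (z : ℝ) : ℝ :=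
  ∑ k ∈ range (n + 1), (-1 : ℝ) ^ k * n.choose k * (n + k).choose k / (z + k)

theorem legendreMoment_succ (n : ℕ) {z : ℝ} (hz : 0 < z) :
    (z + n + 1) * legendreMoment (n + 1) z = (n + 1 - z) * legendreMoment n z := by
  have hext : legendreMoment n z =
      ∑ k ∈ range (n + 1 + 1), (-1 : ℝ) ^ k * n.choose k * (n + k).choose k / (z + k) := by
    rw [Finset.sum_range_succ _ (n + 1)]
    simp [legendreMoment]
  have hzero := sum_alternating_choose_mul_choose n (n + 1)
  rw [Nat.choose_succ_self, Nat.cast_zero, mul_zero, zero_mul] at hzero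
  rw [hext, legendreMoment, ← sub_eq_zero, Finset.mul_sum, Finset.mul_sum,
    ← Finset.sum_sub_distrib, ← mul_zero (2 : ℝ), ← hzero, Finset.mul_sum]
  refine Finset.sum_congr rfl fun k hk => ?_
  have hk : k ≤ n + 1 := Nat.lt_succ_iff.mp (Finset.mem_range.mp hk)
  have hzk : z + k ≠ 0 := by positivity
  have h1 : (n.choose k : ℝ) * (n + 1) = (n + 1).choose k * (n + 1 - k) := by
    have := Nat.choose_mul_succ_eq n k
    rw [show (n + 1 - k : ℝ) = ((n + 1 - k : ℕ) : ℝ) by push_cast [hk]; ring]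
    exact_mod_cast this
  have h2 : ((n + k).choose k : ℝ) * (n + 1 + k) = (n + 1 + k).choose k * (n + 1) := by
    have := Nat.choose_mul_succ_eq (n + k) k
    rw [show n + k + 1 - k = n + 1 by omega, show n + k + 1 = n + 1 + k by ring] at this
    exact_mod_cast this
  have hn : (n + 1 : ℝ) ≠ 0 := by positivity
  rw [eq_div_of_mul_eq hn h1, eq_div_of_mul_eq hn h2.symm]
  field_simp
  ring

theorem legendreMoment_eq (n M : ℕ) :
    legendreMoment n (M + 1) =
      (-1) ^ n * M.factorial * M.descFactorial n / (M + n + 1).factorial := by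
  induction n with
  | zero =>
    simp [legendreMoment, Nat.factorial_succ]
    field_simp
  | succ n ih =>
    have h := legendreMoment_succ n (z := M + 1) (by positivity)
    rw [ih] at h
    have hdesc : (M.descFactorial (n + 1) : ℝ) = (M - n) * M.descFactorial n := by
      rw [Nat.descFactorial_succ]
      rcases le_or_gt n M with h | h
      · push_cast [h]; ring
      · simp [Nat.descFactorial_eq_zero_iff_lt.mpr h]
    rw [hdesc, show M + (n + 1) + 1 = M + n + 1 + 1 by ring, Nat.factorial_succ (M + n + 1)]
    have hpos : (M + 1 + n + 1 : ℝ) ≠ 0 := by positivity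
    rw [eq_div_of_mul_eq hpos ((mul_comm _ _).trans h)]
    push_cast
    have hpos' : (M + n + 1 + 1 : ℝ) ≠ 0 := by positivity
    field_simp
    ring

theorem legendreShifted_eq_sum_one_sub (n : ℕ) (t : ℝ) :
    legendreShifted n t = Real.sqrt (2 * n + 1) *
      ∑ k ∈ range (n + 1), (-1 : ℝ) ^ k * n.choose k * (n + k).choose k * (1 - t) ^ k := by
  have haeval (s : ℝ) : aeval s (shiftedLegendre n) =
      ∑ k ∈ range (n + 1), (-1 : ℝ) ^ k * n.choose k * (n + k).choose k * s ^ k := by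
    have hchoose (k : ℕ) : (n + k).choose n = (n + k).choose k := Nat.choose_symm_add
    simp [shiftedLegendre, hchoose]
  have hsum : ∑ k ∈ range (n + 1), (n.choose k : ℝ) * ((n + k).choose k : ℝ) * (-t) ^ k =
      aeval t (shiftedLegendre n) := by
    rw [haeval]
    refine Finset.sum_congr rfl fun k _ => ?_
    rw [neg_pow]
    ring
  rw [legendreShifted, hsum, shiftedLegendre_eval_symm, ← haeval, mul_comm ((-1 : ℝ) ^ n),
    mul_assoc, ← mul_assoc ((-1 : ℝ) ^ n), ← mul_pow]
  norm_num

theorem continuous_legendreShifted (n : ℕ) : Continuous (legendreShifted n) := by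
  unfold legendreShifted
  fun_prop

theorem integral_one_sub_pow_mul_legendreShifted (n M : ℕ) :
    ∫ t in (0 : ℝ)..1, (1 - t) ^ M * legendreShifted n t =
      Real.sqrt (2 * n + 1) *
        ((-1) ^ n * M.factorial * M.descFactorial n / (M + n + 1).factorial) := by
  simp_rw [legendreShifted_eq_sum_one_sub]
  rw [intervalIntegral.integral_comp_sub_left (fun s : ℝ => s ^ M * (Real.sqrt (2 * n + 1) *
      ∑ k ∈ range (n + 1), (-1 : ℝ) ^ k * n.choose k * (n + k).choose k * s ^ k)) 1,
    ← legendreMoment_eq, legendreMoment]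
  simp only [sub_self, sub_zero, mul_left_comm _ (Real.sqrt _), Finset.mul_sum]
  rw [intervalIntegral.integral_finsetSum fun k _ =>
    Continuous.intervalIntegrable (by fun_prop) _ _]
  refine Finset.sum_congr rfl fun k _ => ?_
  simp only [mul_left_comm (_ ^ M) (_ * _), ← pow_add, intervalIntegral.integral_const_mul,
    integral_pow]
  rw [one_pow, zero_pow (Nat.succ_ne_zero _)]
  push_cast
  ring

theorem hasSum_integral_phiZeroReal_mul (x : ℝ) {p : ℝ → ℝ} (hp : Continuous p) :
    HasSum (fun l : ℕ => (-1 : ℝ) ^ l * x ^ l / (Nat.factorial (2 * l) : ℝ) *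
        ∫ t in (0 : ℝ)..1, (1 - t) ^ (2 * l) * p t)
      (∫ t in (0 : ℝ)..1, phiZeroReal ((1 - t) ^ 2 * x) * p t) := by
  simp_rw [← intervalIntegral.integral_const_mul]
  have hterm (l : ℕ) (t : ℝ) : (-1 : ℝ) ^ l * x ^ l / (Nat.factorial (2 * l) : ℝ) *
      ((1 - t) ^ (2 * l) * p t) =
      (-1 : ℝ) ^ l * ((1 - t) ^ 2 * x) ^ l / (Nat.factorial (2 * l) : ℝ) * p t := by
    rw [mul_pow, pow_mul]
    ring
  have hsummable := summable_pow_div_two_mul_factorial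
  refine intervalIntegral.hasSum_integral_of_dominated_convergence
    (fun l t => |x| ^ l / (Nat.factorial (2 * l) : ℝ) * |p t|) (fun l => ?_) (fun l => ?_) ?_ ?_ ?_
  · exact Continuous.aestronglyMeasurable (by fun_prop)
  · refine Filter.Eventually.of_forall fun t ht => ?_
    rw [Set.uIoc_of_le zero_le_one] at ht
    have h1 : |(1 - t) ^ (2 * l)| ≤ 1 := by
      rw [abs_pow]
      exact pow_le_one₀ (abs_nonneg _) (abs_le.mpr ⟨by linarith [ht.2], by linarith [ht.1]⟩)
    simp only [norm_mul, norm_div, norm_pow, norm_neg, norm_one, one_pow, one_mul,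
      Real.norm_eq_abs, Nat.abs_cast]
    rw [← abs_pow (1 - t)]
    exact mul_le_mul_of_nonneg_left (mul_le_of_le_one_left (abs_nonneg _) h1) (by positivity)
  · exact Filter.Eventually.of_forall fun t _ => (hsummable x).mul_right _
  · simp_rw [tsum_mul_right]
    exact Continuous.intervalIntegrable (by fun_prop) _ _
  · refine Filter.Eventually.of_forall fun t _ => ?_
    simp_rw [hterm]
    refine HasSum.mul_right _ (Summable.hasSum (Summable.of_norm ?_))
    refine (hsummable ((1 - t) ^ 2 * x)).congr fun l => ?_
    rw [norm_div, norm_mul, norm_pow, norm_pow, norm_neg, norm_one, one_pow, one_mul,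
      Real.norm_eq_abs, Real.norm_natCast]

/-- **product formula for the odd trigonometric collocation
coefficients.** For every `x ∈ ℝ` and `j ∈ ℕ`,
`∫₀¹ φ₀((1-ξ)²x) p̂_{2j+1}(ξ) dξ = √(4j+3) (-1)ʲ ((2j+2)!/(4j+4)!) x^{j+1}
  (Σ_{l≥0} (-x/16)ˡ/((3/2)ₗ l!)) (Σ_{l≥0} (-x/16)ˡ/((2j+5/2)ₗ l!))`,
where `(a)ₗ` is the Pochhammer symbol. -/
theorem trigonometric_collocation_coefficient_odd
    (x : ℝ) (j : ℕ) :
    (∫ ξ in (0 : ℝ)..1,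
        phiZeroReal ((1 - ξ) ^ 2 * x) * legendreShifted (2 * j + 1) ξ)
      = Real.sqrt (4 * j + 3) *
          ((-1 : ℝ) ^ j *
            ((Nat.factorial (2 * j + 2) : ℝ) / (Nat.factorial (4 * j + 4) : ℝ)) *
            x ^ (j + 1)) *
          (∑' l : ℕ, (-x / 16) ^ l /
            ((ascPochhammer ℝ l).eval (3 / 2 : ℝ) * (Nat.factorial l : ℝ))) *
          (∑' l : ℕ, (-x / 16) ^ l /
            ((ascPochhammer ℝ l).eval ((2 * j : ℝ) + 5 / 2) * (Nat.factorial l : ℝ))) := by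
  have hlhs := (hasSum_integral_phiZeroReal_mul x
    (continuous_legendreShifted (2 * j + 1))).tsum_eq
  have hsummable := (hasSum_integral_phiZeroReal_mul x
    (continuous_legendreShifted (2 * j + 1))).summable
  simp only [integral_one_sub_pow_mul_legendreShifted] at hlhs hsummable
  rw [← hlhs, ← hsummable.sum_add_tsum_nat_add (j + 1), Finset.sum_eq_zero, zero_add, mul_assoc,
    tsum_mul_tsum_eq_tsum_sum_antidiagonal_of_summable_norm
      (summable_pow_div_ascPochhammer_mul_factorial (by norm_num) _)
      (summable_pow_div_ascPochhammer_mul_factorial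
        (by linarith [Nat.cast_nonneg (α := ℝ) j]) _), ← tsum_mul_left]
  · refine tsum_congr fun m => ?_
    have hconv : ∑ p ∈ antidiagonal m,
        (-x / 16) ^ p.1 / ((ascPochhammer ℝ p.1).eval (3 / 2 : ℝ) * (Nat.factorial p.1 : ℝ)) *
          ((-x / 16) ^ p.2 /
            ((ascPochhammer ℝ p.2).eval ((2 * j : ℝ) + 5 / 2) * (Nat.factorial p.2 : ℝ))) =
        (-x / 16) ^ m * ∑ p ∈ antidiagonal m,
          1 / ((ascPochhammer ℝ p.1).eval (3 / 2 : ℝ) * (Nat.factorial p.1 : ℝ)) *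
          (1 / ((ascPochhammer ℝ p.2).eval ((2 * j : ℝ) + 5 / 2) * (Nat.factorial p.2 : ℝ))) := by
      rw [Finset.mul_sum]
      refine Finset.sum_congr rfl fun p hp => ?_
      rw [← mem_antidiagonal.mp hp, pow_add]
      ring
    have hdesc : ((2 * m + 1).factorial : ℝ) * (2 * (m + (j + 1))).descFactorial (2 * j + 1) =
        (2 * (m + (j + 1))).factorial := by
      have := Nat.factorial_mul_descFactorial (n := 2 * (m + (j + 1))) (k := 2 * j + 1) (by omega)
      rw [show 2 * (m + (j + 1)) - (2 * j + 1) = 2 * m + 1 by omega] at this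
      exact_mod_cast this
    have hfac : ((2 * m + 1).factorial : ℝ) ≠ 0 := by positivity
    rw [hconv, sum_antidiagonal_inv_ascPochhammer_half,
      eq_div_of_mul_eq hfac ((mul_comm _ _).trans hdesc),
      show 2 * (m + (j + 1)) + (2 * j + 1) + 1 = 4 * j + 4 + 2 * m by ring,
      show 2 * (m + (j + 1)) = 2 * j + 2 + 2 * m by ring,
      show (2 * ((2 * j + 1 : ℕ) : ℝ) + 1) = 4 * j + 3 by push_cast; ring,
      div_pow, neg_pow x, pow_add (-1 : ℝ) m, pow_add x m, pow_succ (-1 : ℝ) (2 * j), pow_mul]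
    field_simp
    ring
  · intro l hl
    have : 2 * l < 2 * j + 1 := by have := Finset.mem_range.mp hl; omega
    rw [Nat.descFactorial_eq_zero_iff_lt.mpr this]
    simp
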